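/- arXiv:1810.00391 — 2 statements merged into one kernel-verified Lean document; each statement's English description precedes it below -/
import Mathlib

section
/- Monotonicity of quasi-relative entropy under partial trace: let f be operator convex on (0,∞) with f(1)=0, ρ, σ invertible density matrices on H₁⊗H₂, and K = K₁⊗V with V unitary on H₂. Then S_f^K(ρ||σ) ≥ S_f^{K₁}(ρ₁||σ₁), where ρ₁ = Tr₂ρ, σ₁ = Tr₂σ. -/
open Matrix
open scoped Kronecker ComplexOrder

/-- The rank-one operator `|v⟩⟨v|`. -/
noncomputable def outer {ι : Type*} [Fintype ι] (v : ι → ℂ) : Matrix ι ι ℂ :=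
  Matrix.vecMulVec v (star v)

/-- The quasi-relative entropy `S_f^K(ρ||σ) = Σ_{j,k} λ_j f(μ_k/λ_j) |⟨φ_k|K|ψ_j⟩|²`,
expressed via the spectral data of `ρ` and `σ`. -/
noncomputable def quasiEntropy {ι : Type*} [Fintype ι] (f : ℝ → ℝ) (K : Matrix ι ι ℂ)
    (lam : ι → ℝ) (ψ : ι → ι → ℂ) (mu : ι → ℝ) (φ : ι → ι → ℂ) : ℝ :=
  ∑ j, ∑ k, lam j * f (mu k / lam j) * ‖star (φ k) ⬝ᵥ (K *ᵥ ψ j)‖ ^ 2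

/-- Functional calculus of a Hermitian matrix. -/
noncomputable def herCFC {m : Type*} [Fintype m] [DecidableEq m] (f : ℝ → ℝ)
    {A : Matrix m m ℂ} (hA : A.IsHermitian) : Matrix m m ℂ :=
  (hA.eigenvectorUnitary : Matrix m m ℂ) *
    Matrix.diagonal (fun i => (f (hA.eigenvalues i) : ℂ)) *
      star (hA.eigenvectorUnitary : Matrix m m ℂ)

/-- `f` is operator convex on `(0,∞)`: `f((A+B)/2) ≤ (f(A)+f(B))/2` in the Loewner order,
for all positive definite matrices `A`, `B` of any size. -/
def OperatorConvexOn (f : ℝ → ℝ) : Prop :=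
  ∀ (m : ℕ) (A B : Matrix (Fin m) (Fin m) ℂ) (hA : A.PosDef) (hB : B.PosDef)
    (hm : ((2 : ℂ)⁻¹ • (A + B)).IsHermitian),
    ((2 : ℂ)⁻¹ • (herCFC f hA.1 + herCFC f hB.1) - herCFC f hm).PosSemidef

/-- Partial trace over the second tensor factor. -/
noncomputable def ptrace2 {ι₁ ι₂ : Type*} [Fintype ι₁] [Fintype ι₂]
    (ρ : Matrix (ι₁ × ι₂) (ι₁ × ι₂) ℂ) : Matrix ι₁ ι₁ ℂ :=
  Matrix.of fun i j => ∑ k, ρ (i, k) (j, k)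

/-- The functional calculus intertwines whatever the matrix intertwines with a diagonal matrix. -/
lemma herCFC_mul_of_mul_eq_mul_diagonal {n m : Type*} [Fintype n] [DecidableEq n] [Fintype m]
    [DecidableEq m] (f : ℝ → ℝ) {A : Matrix n n ℂ} (hA : A.IsHermitian) (X : Matrix n m ℂ)
    (a : m → ℝ) (h : A * X = X * diagonal (fun i => (a i : ℂ))) :
    herCFC f hA * X = X * diagonal (fun i => (f (a i) : ℂ)) := by
  set S : Matrix n n ℂ := (hA.eigenvectorUnitary : Matrix n n ℂ) with hS
  have hSS : star S * S = 1 := Unitary.coe_star_mul_self hA.eigenvectorUnitary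
  have hSS' : S * star S = 1 := Unitary.coe_mul_star_self hA.eigenvectorUnitary
  have hspec : A = S * diagonal (fun i => (hA.eigenvalues i : ℂ)) * star S := by
    have := hA.spectral_theorem
    rw [Unitary.conjStarAlgAut_apply] at this
    exact this
  have h1 : diagonal (fun i => (hA.eigenvalues i : ℂ)) * (star S * X)
      = star S * X * diagonal (fun i => (a i : ℂ)) := by
    calc _ = star S * S * diagonal (fun i => (hA.eigenvalues i : ℂ)) * (star S * X) := by
          rw [hSS, one_mul]
      _ = star S * ((S * diagonal (fun i => (hA.eigenvalues i : ℂ)) * star S) * X) := by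
          simp only [mul_assoc, Matrix.mul_assoc]
      _ = _ := by rw [← hspec, h, Matrix.mul_assoc]
  have h2 : diagonal (fun i => (f (hA.eigenvalues i) : ℂ)) * (star S * X)
      = star S * X * diagonal (fun i => (f (a i) : ℂ)) := by
    ext i j
    have := congrFun (congrFun h1 i) j
    simp only [diagonal_mul, mul_diagonal] at this ⊢
    by_cases hz : (star S * X) i j = 0
    · simp [hz]
    · rw [mul_comm] at this
      have h3 : hA.eigenvalues i = a j := by exact_mod_cast mul_left_cancel₀ hz this
      rw [h3, mul_comm]
  calc herCFC f hA * X = S * (diagonal (fun i => (f (hA.eigenvalues i) : ℂ)) * (star S * X)) := by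
        simp only [herCFC, ← hS, Matrix.mul_assoc]
    _ = S * star S * X * diagonal (fun i => (f (a i) : ℂ)) := by
        rw [h2]; simp only [Matrix.mul_assoc]
    _ = _ := by rw [hSS', Matrix.one_mul]

lemma star_dotProduct_diagonal_mulVec {n : Type*} [Fintype n] [DecidableEq n] (a : n → ℝ)
    (x : n → ℂ) :
    star x ⬝ᵥ (diagonal (fun i => (a i : ℂ)) *ᵥ x) = ((∑ i, a i * ‖x i‖ ^ 2 : ℝ) : ℂ) := by
  simp only [dotProduct, mulVec_diagonal, Pi.star_apply, Complex.ofReal_sum, Complex.ofReal_mul,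
    Complex.ofReal_pow]
  refine Finset.sum_congr rfl fun i _ => ?_
  rw [← Complex.conj_mul']
  simp only [RCLike.star_def]
  ring

/-- Jensen's operator inequality for an isometry `U` that compresses a diagonal matrix indexed by
`Fin N` to a diagonal matrix. -/
lemma OperatorConvexOn.jensen_fin {f : ℝ → ℝ} (hf : OperatorConvexOn f) {N : ℕ} {m : Type*}
    [Fintype m] [DecidableEq m] (U : Matrix (Fin N) m ℂ) (hU : Uᴴ * U = 1) (d : Fin N → ℝ)
    (hd : ∀ i, 0 < d i) (e : m → ℝ)
    (he : Uᴴ * diagonal (fun i => (d i : ℂ)) * U = diagonal (fun i => (e i : ℂ)))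
    (x : m → ℂ) :
    ∑ i, f (e i) * ‖x i‖ ^ 2 ≤ ∑ i, f (d i) * ‖(U *ᵥ x) i‖ ^ 2 := by
  set A : Matrix (Fin N) (Fin N) ℂ := diagonal (fun i => (d i : ℂ)) with hA
  set W : Matrix (Fin N) (Fin N) ℂ := (2 : ℂ) • (U * Uᴴ) - 1 with hW
  have hWh : Wᴴ = W := by simp [hW, conjTranspose_sub, conjTranspose_smul]
  have hWU : W * U = U := by
    rw [hW, Matrix.sub_mul, Matrix.smul_mul, Matrix.mul_assoc, hU, Matrix.mul_one, Matrix.one_mul,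
      two_smul, add_sub_cancel_right]
  have hUW : Uᴴ * W = Uᴴ := by
    simpa [hWh] using congrArg conjTranspose hWU
  have hWW : W * W = 1 := by
    conv_lhs => rw [hW, Matrix.sub_mul, Matrix.smul_mul, Matrix.mul_assoc, hUW, Matrix.one_mul]
    abel
  have hAp : A.PosDef := by
    rw [hA, posDef_diagonal_iff]
    intro i
    exact_mod_cast hd i
  have hBp : (W * A * W).PosDef := by
    have hinj : Function.Injective W.mulVec := by
      intro u v huv
      have := congrArg (W *ᵥ ·) huv
      simpa [mulVec_mulVec, hWW] using this
    have := hAp.conjTranspose_mul_mul_same hinj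
    rwa [hWh] at this
  have hCh : ((2 : ℂ)⁻¹ • (A + W * A * W)).IsHermitian := by
    have := hAp.1.add hBp.1
    rw [IsHermitian, conjTranspose_smul, this.eq]
    simp
  have hCU : ((2 : ℂ)⁻¹ • (A + W * A * W)) * U = U * diagonal (fun i => (e i : ℂ)) := by
    rw [← he, Matrix.smul_mul, Matrix.add_mul, Matrix.mul_assoc (W * A), hWU, hW,
      Matrix.sub_mul, Matrix.sub_mul, Matrix.one_mul, add_sub_cancel, Matrix.smul_mul,
      Matrix.smul_mul, smul_smul]
    simp only [Matrix.mul_assoc]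
    norm_num
  have hfA := herCFC_mul_of_mul_eq_mul_diagonal f hAp.1 1 d (by rw [Matrix.mul_one, Matrix.one_mul])
  have hfB := herCFC_mul_of_mul_eq_mul_diagonal f hBp.1 W d
    (by rw [Matrix.mul_assoc, hWW, Matrix.mul_one])
  have hfC := herCFC_mul_of_mul_eq_mul_diagonal f hCh U e hCU
  rw [Matrix.mul_one, Matrix.one_mul] at hfA
  have hWx : W *ᵥ (U *ᵥ x) = U *ᵥ x := by rw [mulVec_mulVec, hWU]
  have qA : star (U *ᵥ x) ⬝ᵥ (herCFC f hAp.1 *ᵥ (U *ᵥ x))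
      = ((∑ i, f (d i) * ‖(U *ᵥ x) i‖ ^ 2 : ℝ) : ℂ) := by
    rw [hfA, star_dotProduct_diagonal_mulVec (fun i => f (d i))]
  have qB : star (U *ᵥ x) ⬝ᵥ (herCFC f hBp.1 *ᵥ (U *ᵥ x))
      = ((∑ i, f (d i) * ‖(U *ᵥ x) i‖ ^ 2 : ℝ) : ℂ) := by
    have h1 : herCFC f hBp.1 *ᵥ (U *ᵥ x)
        = W *ᵥ (diagonal (fun i => (f (d i) : ℂ)) *ᵥ (U *ᵥ x)) := by
      conv_lhs => rw [← hWx, mulVec_mulVec, hfB]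
      rw [← mulVec_mulVec]
    have h2 : star (U *ᵥ x) ᵥ* W = star (U *ᵥ x) := by
      conv_rhs => rw [← hWx, star_mulVec, hWh]
    rw [h1, dotProduct_mulVec, h2, star_dotProduct_diagonal_mulVec (fun i => f (d i))]
  have qC : star (U *ᵥ x) ⬝ᵥ (herCFC f hCh *ᵥ (U *ᵥ x))
      = ((∑ i, f (e i) * ‖x i‖ ^ 2 : ℝ) : ℂ) := by
    rw [mulVec_mulVec, hfC, ← mulVec_mulVec, star_mulVec, dotProduct_mulVec, vecMul_vecMul, hU,
      vecMul_one, star_dotProduct_diagonal_mulVec (fun i => f (e i))]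
  have key := (hf N A (W * A * W) hAp hBp hCh).dotProduct_mulVec_nonneg (U *ᵥ x)
  rw [sub_mulVec, smul_mulVec, add_mulVec, dotProduct_sub, dotProduct_smul, dotProduct_add,
    qA, qB, qC, smul_eq_mul, ← two_mul, inv_mul_cancel_left₀ two_ne_zero, sub_nonneg] at key
  exact_mod_cast key

/-- Jensen's operator inequality for an isometry `U` that compresses a diagonal matrix to a
diagonal matrix. -/
lemma OperatorConvexOn.jensen {f : ℝ → ℝ} (hf : OperatorConvexOn f) {n m : Type*}
    [Fintype n] [DecidableEq n] [Fintype m] [DecidableEq m] (U : Matrix n m ℂ) (hU : Uᴴ * U = 1)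
    (d : n → ℝ) (hd : ∀ i, 0 < d i) (e : m → ℝ)
    (he : Uᴴ * diagonal (fun i => (d i : ℂ)) * U = diagonal (fun i => (e i : ℂ)))
    (x : m → ℂ) :
    ∑ i, f (e i) * ‖x i‖ ^ 2 ≤ ∑ i, f (d i) * ‖(U *ᵥ x) i‖ ^ 2 := by
  let g := (Fintype.equivFin n).symm
  have h := hf.jensen_fin (U.submatrix g id) (by
      rw [conjTranspose_submatrix, submatrix_mul_equiv, hU, submatrix_id_id])
    (d ∘ g) (fun i => hd _) e (by
      have hdg : diagonal (fun i => (((d ∘ g) i : ℝ) : ℂ))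
          = (diagonal (fun i => (d i : ℂ))).submatrix g g :=
        (submatrix_diagonal_equiv (fun i => (d i : ℂ)) g).symm
      rw [conjTranspose_submatrix, hdg, submatrix_mul_equiv, submatrix_mul_equiv, he,
        submatrix_id_id]) x
  refine h.trans_eq ?_
  exact Equiv.sum_comp g (fun i => f (d i) * ‖(U *ᵥ x) i‖ ^ 2)

lemma sum_outer_eq_one {n : Type*} [Fintype n] [DecidableEq n] (ψ : n → n → ℂ)
    (hψ : ∀ i j, star (ψ i) ⬝ᵥ ψ j = if i = j then 1 else 0) : ∑ j, outer (ψ j) = 1 := by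
  have h1 : (of ψ)ᵀᴴ * (of ψ)ᵀ = 1 := by
    ext i j
    simpa [mul_apply, one_apply, dotProduct] using hψ i j
  have h2 := mul_eq_one_comm.mp h1
  rw [← h2]
  ext i j
  simp [mul_apply, outer, vecMulVec_apply, Matrix.sum_apply]

lemma sum_smul_outer_mulVec {n : Type*} [Fintype n] [DecidableEq n] (ψ : n → n → ℂ)
    (hψ : ∀ i j, star (ψ i) ⬝ᵥ ψ j = if i = j then 1 else 0) (a : n → ℝ) (j : n) :
    (∑ i, (a i : ℂ) • outer (ψ i)) *ᵥ ψ j = (a j : ℂ) • ψ j := by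
  simp [sum_mulVec, smul_mulVec, outer, vecMulVec_mulVec, hψ]

/-- The trace form `Tr (Xᴴ B Y A)` in terms of spectral data of `A` and `B`. -/
lemma trace_mul_sum_outer {n : Type*} [Fintype n] (X Y : Matrix n n ℂ) (a b : n → ℂ)
    (ψ φ : n → n → ℂ) :
    trace (Xᴴ * (∑ k, b k • outer (φ k)) * Y * ∑ j, a j • outer (ψ j))
      = ∑ j, ∑ k, a j * b k *
        (star (star (φ k) ⬝ᵥ (X *ᵥ ψ j)) * (star (φ k) ⬝ᵥ (Y *ᵥ ψ j))) := by
  simp only [Finset.mul_sum, Finset.sum_mul, trace_sum, Matrix.mul_smul, Matrix.smul_mul,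
    trace_smul, smul_eq_mul]
  refine Finset.sum_congr rfl fun j _ => Finset.sum_congr rfl fun k _ => ?_
  have h : Xᴴ *ᵥ φ k ⬝ᵥ star (ψ j) = star (star (φ k) ⬝ᵥ (X *ᵥ ψ j)) := by
    rw [← star_dotProduct_star, star_star, star_mulVec, ← dotProduct_mulVec, dotProduct_comm]
  rw [outer, outer, mul_vecMulVec, trace_vecMulVec, ← mulVec_mulVec, ← mulVec_mulVec,
    vecMulVec_mulVec, mulVec_smul, smul_dotProduct, h, MulOpposite.smul_eq_mul_unop,
    MulOpposite.unop_op]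
  ring

lemma trace_kronecker_one_mul {n m : Type*} [Fintype n] [Fintype m] [DecidableEq m]
    (X : Matrix n n ℂ) (ρ : Matrix (n × m) (n × m) ℂ) :
    trace ((X ⊗ₖ (1 : Matrix m m ℂ)) * ρ) = trace (X * ptrace2 ρ) := by
  simp only [trace, diag_apply, mul_apply, Fintype.sum_prod_type, kroneckerMap_apply, one_apply,
    ptrace2, of_apply, mul_ite, mul_one, mul_zero, ite_mul, zero_mul, Finset.sum_ite_eq,
    Finset.mem_univ, if_true, Finset.mul_sum]
  exact Finset.sum_congr rfl fun i _ => Finset.sum_comm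

lemma trace_vecMulVec_mul {n : Type*} [Fintype n] (u v : n → ℂ) (A : Matrix n n ℂ) :
    trace (vecMulVec u v * A) = v ⬝ᵥ (A *ᵥ u) := by
  rw [vecMulVec_mul, trace_vecMulVec, dotProduct_comm, dotProduct_mulVec]

/-- Expansion of a matrix in the rank-one operators built from two orthonormal bases. -/
lemma sum_smul_vecMulVec_eq {n : Type*} [Fintype n] [DecidableEq n] (ψ φ : n → n → ℂ)
    (hψ : ∀ i j, star (ψ i) ⬝ᵥ ψ j = if i = j then 1 else 0)
    (hφ : ∀ i j, star (φ i) ⬝ᵥ φ j = if i = j then 1 else 0) (K : Matrix n n ℂ) :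
    ∑ p : n × n, (star (φ p.2) ⬝ᵥ (K *ᵥ ψ p.1)) • vecMulVec (φ p.2) (star (ψ p.1)) = K := by
  have h : K = (∑ k, outer (φ k)) * K * ∑ j, outer (ψ j) := by
    rw [sum_outer_eq_one φ hφ, sum_outer_eq_one ψ hψ, one_mul, mul_one]
  conv_rhs => rw [h]
  simp only [Finset.mul_sum, Finset.sum_mul, Fintype.sum_prod_type]
  refine Finset.sum_congr rfl fun j _ => Finset.sum_congr rfl fun k _ => ?_
  rw [outer, outer, vecMulVec_mul, vecMulVec_mul_vecMulVec, dotProduct_mulVec, vecMulVec_smul]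

lemma trace_kronecker_vecMulVec_right {n m : Type*} [Fintype n] [Fintype m] [DecidableEq n]
    [DecidableEq m] (ρ : Matrix (n × m) (n × m) ℂ) (V : Matrix m m ℂ)
    (hV : V ∈ Matrix.unitaryGroup m ℂ) (l : n → ℝ) (ψ φ : n → n → ℂ)
    (hψ : ∀ i j, star (ψ i) ⬝ᵥ ψ j = if i = j then 1 else 0)
    (hφ : ∀ i j, star (φ i) ⬝ᵥ φ j = if i = j then 1 else 0)
    (hρ : ptrace2 ρ = ∑ j, (l j : ℂ) • outer (ψ j)) (p q : n × n) :
    trace ((vecMulVec (φ p.2) (star (ψ p.1)) ⊗ₖ V)ᴴ *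
        (vecMulVec (φ q.2) (star (ψ q.1)) ⊗ₖ V) * ρ)
      = if p = q then (l p.1 : ℂ) else 0 := by
  have hVV : Vᴴ * V = 1 := mem_unitaryGroup_iff'.mp hV
  rw [conjTranspose_kronecker, ← mul_kronecker_mul, hVV, trace_kronecker_one_mul,
    conjTranspose_vecMulVec, star_star, vecMulVec_mul_vecMulVec, hφ, vecMulVec_smul,
    Matrix.smul_mul, trace_smul, trace_vecMulVec_mul, hρ, sum_smul_outer_mulVec ψ hψ,
    dotProduct_smul, hψ]
  obtain ⟨p1, p2⟩ := p
  obtain ⟨q1, q2⟩ := q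
  by_cases h1 : p1 = q1 <;> by_cases h2 : p2 = q2 <;> simp [h1, h2, eq_comm]

lemma trace_kronecker_vecMulVec_left {n m : Type*} [Fintype n] [Fintype m] [DecidableEq n]
    [DecidableEq m] (σ : Matrix (n × m) (n × m) ℂ) (V : Matrix m m ℂ)
    (hV : V ∈ Matrix.unitaryGroup m ℂ) (l : n → ℝ) (ψ φ : n → n → ℂ)
    (hψ : ∀ i j, star (ψ i) ⬝ᵥ ψ j = if i = j then 1 else 0)
    (hφ : ∀ i j, star (φ i) ⬝ᵥ φ j = if i = j then 1 else 0)
    (hσ : ptrace2 σ = ∑ j, (l j : ℂ) • outer (φ j)) (p q : n × n) :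
    trace ((vecMulVec (φ p.2) (star (ψ p.1)) ⊗ₖ V)ᴴ * σ *
        (vecMulVec (φ q.2) (star (ψ q.1)) ⊗ₖ V))
      = if p = q then (l p.2 : ℂ) else 0 := by
  have hVV : V * Vᴴ = 1 := mem_unitaryGroup_iff.mp hV
  rw [trace_mul_comm, ← Matrix.mul_assoc, conjTranspose_kronecker, ← mul_kronecker_mul, hVV,
    trace_kronecker_one_mul, conjTranspose_vecMulVec, star_star, vecMulVec_mul_vecMulVec, hψ,
    vecMulVec_smul, Matrix.smul_mul, trace_smul, trace_vecMulVec_mul, hσ,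
    sum_smul_outer_mulVec φ hφ, dotProduct_smul, hφ]
  obtain ⟨p1, p2⟩ := p
  obtain ⟨q1, q2⟩ := q
  by_cases h1 : p1 = q1 <;> by_cases h2 : p2 = q2 <;> simp [h1, h2, eq_comm]

/-- Monotonicity of the quasi-relative entropy under partial trace:
`S_f^{K₁⊗V}(ρ||σ) ≥ S_f^{K₁}(ρ₁||σ₁)` for operator convex `f` with `f(1)=0`, invertible
density matrices `ρ`, `σ` on `H₁⊗H₂`, and `K = K₁⊗V` with `V` unitary. -/
theorem quasiEntropy_monotone {ι₁ ι₂ : Type*} [Fintype ι₁] [Fintype ι₂]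
    [DecidableEq ι₁] [DecidableEq ι₂]
    (f : ℝ → ℝ) (hf : OperatorConvexOn f) (hf1 : f 1 = 0)
    (ρ σ : Matrix (ι₁ × ι₂) (ι₁ × ι₂) ℂ)
    (K₁ : Matrix ι₁ ι₁ ℂ) (V : Matrix ι₂ ι₂ ℂ) (hV : V ∈ Matrix.unitaryGroup ι₂ ℂ)
    (lam : ι₁ × ι₂ → ℝ) (ψ : ι₁ × ι₂ → ι₁ × ι₂ → ℂ)
    (mu : ι₁ × ι₂ → ℝ) (φ : ι₁ × ι₂ → ι₁ × ι₂ → ℂ)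
    (hψ : ∀ i j, star (ψ i) ⬝ᵥ ψ j = if i = j then 1 else 0)
    (hφ : ∀ i j, star (φ i) ⬝ᵥ φ j = if i = j then 1 else 0)
    (hlam : ∀ j, 0 < lam j) (hmu : ∀ k, 0 < mu k)
    (hρ : ρ = ∑ j, (lam j : ℂ) • outer (ψ j))
    (hσ : σ = ∑ k, (mu k : ℂ) • outer (φ k))
    (hρtr : ∑ j, lam j = 1) (hσtr : ∑ k, mu k = 1)
    (lam₁ : ι₁ → ℝ) (ψ₁ : ι₁ → ι₁ → ℂ) (mu₁ : ι₁ → ℝ) (φ₁ : ι₁ → ι₁ → ℂ)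
    (hψ₁ : ∀ i j, star (ψ₁ i) ⬝ᵥ ψ₁ j = if i = j then 1 else 0)
    (hφ₁ : ∀ i j, star (φ₁ i) ⬝ᵥ φ₁ j = if i = j then 1 else 0)
    (hlam₁ : ∀ j, 0 < lam₁ j) (hmu₁ : ∀ k, 0 < mu₁ k)
    (hρ₁ : ptrace2 ρ = ∑ j, (lam₁ j : ℂ) • outer (ψ₁ j))
    (hσ₁ : ptrace2 σ = ∑ k, (mu₁ k : ℂ) • outer (φ₁ k)) :
    quasiEntropy f K₁ lam₁ ψ₁ mu₁ φ₁ ≤ quasiEntropy f (K₁ ⊗ₖ V) lam ψ mu φ := by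
  set E : ι₁ × ι₁ → Matrix ι₁ ι₁ ℂ := fun p => vecMulVec (φ₁ p.2) (star (ψ₁ p.1)) with hE
  set b : Matrix (ι₁ × ι₂) (ι₁ × ι₂) ℂ → (ι₁ × ι₂) × (ι₁ × ι₂) → ℂ :=
    fun X q => star (φ q.2) ⬝ᵥ (X *ᵥ ψ q.1) with hb
  set U : Matrix ((ι₁ × ι₂) × (ι₁ × ι₂)) (ι₁ × ι₁) ℂ :=
    of fun q p => ((√(lam q.1) / √(lam₁ p.1) : ℝ) : ℂ) * b (E p ⊗ₖ V) q with hUdef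
  have hsq : ∀ j, (√(lam j) : ℂ) * √(lam j) = lam j := fun j => by
    exact_mod_cast Real.mul_self_sqrt (hlam j).le
  have hsq₁ : ∀ j, (√(lam₁ j) : ℂ) * √(lam₁ j) = lam₁ j := fun j => by
    exact_mod_cast Real.mul_self_sqrt (hlam₁ j).le
  have hne₁ : ∀ j, (lam₁ j : ℂ) ≠ 0 := fun j => by exact_mod_cast (hlam₁ j).ne'
  have hne : ∀ j, (lam j : ℂ) ≠ 0 := fun j => by exact_mod_cast (hlam j).ne'
  have hentry : ∀ (w : (ι₁ × ι₂) × (ι₁ × ι₂) → ℂ) (p p' : ι₁ × ι₁),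
      (Uᴴ * diagonal w * U) p p' = ((√(lam₁ p.1) : ℂ) * √(lam₁ p'.1))⁻¹ *
        ∑ j, ∑ k, (lam j * w (j, k)) * (star (b (E p ⊗ₖ V) (j, k)) * b (E p' ⊗ₖ V) (j, k)) := by
    intro w p p'
    rw [mul_apply]
    simp only [mul_diagonal, conjTranspose_apply, Fintype.sum_prod_type (α₁ := ι₁ × ι₂),
      Finset.mul_sum (s := (Finset.univ : Finset (ι₁ × ι₂)))]
    refine Finset.sum_congr rfl fun j _ => Finset.sum_congr rfl fun k _ => ?_
    simp only [hUdef, of_apply, star_mul', RCLike.star_def, Complex.conj_ofReal,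
      Complex.ofReal_div, map_div₀, ← hsq, mul_inv]
    ring
  have hUU : Uᴴ * U = 1 := by
    ext p p'
    have h := trace_mul_sum_outer (E p ⊗ₖ V) (E p' ⊗ₖ V) (fun j => (lam j : ℂ)) (fun _ => 1) ψ φ
    simp only [one_smul, sum_outer_eq_one φ hφ, Matrix.mul_one, ← hρ] at h
    rw [trace_kronecker_vecMulVec_right ρ V hV lam₁ ψ₁ φ₁ hψ₁ hφ₁ hρ₁] at h
    have h' := hentry (fun _ => 1) p p'
    rw [diagonal_one, Matrix.mul_one] at h'
    rw [h', ← h, one_apply]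
    split_ifs with hp
    · rw [← hp, hsq₁, inv_mul_cancel₀ (hne₁ _)]
    · rw [mul_zero]
  have hUD : Uᴴ * diagonal (fun q : (ι₁ × ι₂) × (ι₁ × ι₂) => ((mu q.2 / lam q.1 : ℝ) : ℂ)) * U
      = diagonal (fun p : ι₁ × ι₁ => ((mu₁ p.2 / lam₁ p.1 : ℝ) : ℂ)) := by
    ext p p'
    have h := trace_mul_sum_outer (E p ⊗ₖ V) (E p' ⊗ₖ V) (fun _ => 1) (fun k => (mu k : ℂ)) ψ φ
    simp only [one_smul, sum_outer_eq_one ψ hψ, Matrix.mul_one, ← hσ] at h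
    rw [trace_kronecker_vecMulVec_left σ V hV mu₁ ψ₁ φ₁ hψ₁ hφ₁ hσ₁] at h
    rw [hentry]
    simp only [Complex.ofReal_div, mul_div_cancel₀ _ (hne _)]
    simp only [one_mul] at h
    rw [← h, diagonal_apply]
    split_ifs with hp
    · rw [← hp, hsq₁, inv_mul_eq_div]
    · rw [mul_zero]
  have hUx : ∀ q, (U *ᵥ fun p => (√(lam₁ p.1) : ℂ) * (star (φ₁ p.2) ⬝ᵥ (K₁ *ᵥ ψ₁ p.1))) q
      = √(lam q.1) * b (K₁ ⊗ₖ V) q := by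
    intro q
    have hK : K₁ ⊗ₖ V = ∑ p, (star (φ₁ p.2) ⬝ᵥ (K₁ *ᵥ ψ₁ p.1)) • (E p ⊗ₖ V) := by
      conv_lhs => rw [← sum_smul_vecMulVec_eq ψ₁ φ₁ hψ₁ hφ₁ K₁]
      ext i j
      simp [Matrix.sum_apply, Finset.sum_mul, hE, mul_assoc]
    rw [hK]
    simp only [hb, sum_mulVec, smul_mulVec, dotProduct_sum, dotProduct_smul, Finset.mul_sum]
    rw [mulVec, dotProduct]
    refine Finset.sum_congr rfl fun p _ => ?_
    have h0 : (√(lam₁ p.1) : ℂ) ≠ 0 := by exact_mod_cast (Real.sqrt_pos.mpr (hlam₁ _)).ne'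
    simp only [hUdef, of_apply, hb, Complex.ofReal_div, smul_eq_mul]
    field_simp
  have hJ := hf.jensen U hUU (fun q => mu q.2 / lam q.1) (fun q => div_pos (hmu _) (hlam _))
    (fun p => mu₁ p.2 / lam₁ p.1) hUD
    (fun p => (√(lam₁ p.1) : ℂ) * (star (φ₁ p.2) ⬝ᵥ (K₁ *ᵥ ψ₁ p.1)))
  simp only [hUx, norm_mul, mul_pow, Complex.norm_real, Real.norm_eq_abs, sq_abs,
    Real.sq_sqrt (hlam _).le, Real.sq_sqrt (hlam₁ _).le] at hJ
  rw [Fintype.sum_prod_type, Fintype.sum_prod_type (α₁ := ι₁ × ι₂)] at hJ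
  simp only [mul_comm (f _) _, mul_right_comm _ _ (f _)] at hJ
  exact hJ
end

section
/- Joint convexity of quasi-relative entropy: for an operator monotone decreasing f on (0,∞) with f(1)=0, any operator K, weights p_j > 0 with Σ p_j = 1, and invertible density matrices ρ_j, σ_j with ρ = Σ_j p_j ρ_j and σ = Σ_j p_j σ_j, one has S_f^K(ρ||σ) ≤ Σ_j p_j S_f^K(ρ_j||σ_j). -/
open Matrix
open scoped ComplexOrder

/-- `f` is operator monotone decreasing on `(0,∞)`: `A ≤ B` implies `f(B) ≤ f(A)` in the
Loewner order, for positive definite matrices of any size. -/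
def OperatorMonotoneDecrOn (f : ℝ → ℝ) : Prop :=
  ∀ (m : ℕ) (A B : Matrix (Fin m) (Fin m) ℂ) (hA : A.PosDef) (hB : B.PosDef),
    (B - A).PosSemidef → (herCFC f hA.1 - herCFC f hB.1).PosSemidef

/-- If `X` intertwines `A` with a diagonal matrix, then it intertwines `f(A)` with its image
under `f`. -/
theorem herCFC_mul_of_mul_eq {m n : Type*} [Fintype m] [DecidableEq m] [Fintype n]
    [DecidableEq n] (f : ℝ → ℝ) {A : Matrix m m ℂ} (hA : A.IsHermitian) {X : Matrix m n ℂ}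
    {d : n → ℝ} (h : A * X = X * diagonal (fun i => (d i : ℂ))) :
    herCFC f hA * X = X * diagonal (fun i => (f (d i) : ℂ)) := by
  set U : Matrix m m ℂ := (hA.eigenvectorUnitary : Matrix m m ℂ) with hU
  have hUU : star U * U = 1 := Unitary.coe_star_mul_self hA.eigenvectorUnitary
  have hUU' : U * star U = 1 := Unitary.coe_mul_star_self hA.eigenvectorUnitary
  have hspec : A = U * diagonal (fun i => (hA.eigenvalues i : ℂ)) * star U := by
    have := hA.spectral_theorem
    rw [Unitary.conjStarAlgAut_apply] at this
    exact this
  have hW : diagonal (fun i => (hA.eigenvalues i : ℂ)) * (star U * X) =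
      (star U * X) * diagonal (fun i => (d i : ℂ)) := by
    rw [Matrix.mul_assoc, ← h]
    conv_rhs => rw [hspec]
    simp only [← Matrix.mul_assoc, hUU, Matrix.one_mul]
  have hfW : diagonal (fun i => (f (hA.eigenvalues i) : ℂ)) * (star U * X) =
      (star U * X) * diagonal (fun i => (f (d i) : ℂ)) := by
    ext i j
    have hij := congr_fun (congr_fun hW i) j
    rw [diagonal_mul, mul_diagonal, mul_comm] at hij ⊢
    by_cases hz : (star U * X) i j = 0
    · simp [hz]
    · rw [Complex.ofReal_injective (mul_left_cancel₀ hz hij)]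
  rw [herCFC, ← hU, Matrix.mul_assoc, Matrix.mul_assoc, hfW, ← Matrix.mul_assoc,
    ← Matrix.mul_assoc, hUU', Matrix.one_mul]

theorem re_star_dotProduct_diagonal_mulVec {n : Type*} [Fintype n] [DecidableEq n] (a : n → ℝ)
    (y : n → ℂ) :
    (star y ⬝ᵥ (diagonal (fun i => (a i : ℂ)) *ᵥ y)).re = ∑ i, a i * ‖y i‖ ^ 2 := by
  simp only [dotProduct, mulVec_diagonal, Complex.re_sum, Pi.star_apply]
  refine Finset.sum_congr rfl fun i _ => ?_
  rw [mul_left_comm, Complex.star_def, Complex.conj_mul', ← Complex.ofReal_pow,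
    ← Complex.ofReal_mul, Complex.ofReal_re]

theorem pinching_sub_eq {m : Type*} [Fintype m] [DecidableEq m] {P : Matrix m m ℂ}
    (hP : P * P = P) (T : Matrix m m ℂ) (C : ℂ) {ε : ℂ} (hε : ε ≠ 0) :
    P * T * P + ε • P + C • (1 - P) - T =
      ε⁻¹ • ((ε • P - (1 - P) * T * P) * (ε • P - P * T * (1 - P))) +
        (1 - P) * (C • 1 - (T + ε⁻¹ • (T * T))) * (1 - P) +
        ε⁻¹ • ((1 - P) * T * (1 - P) * ((1 - P) * T * (1 - P))) := by
  have hP' : ∀ X : Matrix m m ℂ, P * (P * X) = P * X := fun X => by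
    rw [← Matrix.mul_assoc, hP]
  simp only [Matrix.mul_sub, Matrix.sub_mul, Matrix.mul_add, Matrix.add_mul, Matrix.mul_one,
    Matrix.one_mul, Matrix.mul_assoc, hP, hP', Matrix.smul_mul, Matrix.mul_smul, smul_sub,
    smul_smul, inv_mul_cancel₀ hε, inv_mul_cancel_left₀ hε, one_smul]
  module

/-- For a projection `P`, the matrix `T` is dominated by `PTP + εP + C(1 - P)` once `C` is large. -/
theorem posSemidef_pinching_sub {m : Type*} [Fintype m] [DecidableEq m] {P T : Matrix m m ℂ}
    (hPP : P * P = P) (hP : P.IsHermitian) (hT : T.IsHermitian) {C ε : ℝ} (hε : 0 < ε)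
    (hD : ((C : ℂ) • 1 - (T + (ε : ℂ)⁻¹ • (T * T))).PosSemidef) :
    (P * T * P + (ε : ℂ) • P + (C : ℂ) • (1 - P) - T).PosSemidef := by
  have hR : (1 - P)ᴴ = 1 - P := by rw [conjTranspose_sub, conjTranspose_one, hP.eq]
  have hεc : (0 : ℂ) ≤ (ε : ℂ)⁻¹ := by
    rw [← Complex.ofReal_inv]
    exact Complex.zero_le_real.mpr (inv_nonneg.mpr hε.le)
  have hY := posSemidef_conjTranspose_mul_self ((ε : ℂ) • P - P * T * (1 - P))
  have hZ := posSemidef_conjTranspose_mul_self ((1 - P) * T * (1 - P))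
  have hRDR := hD.conjTranspose_mul_mul_same (1 - P)
  have hYH : ((ε : ℂ) • P - P * T * (1 - P))ᴴ = (ε : ℂ) • P - (1 - P) * T * P := by
    rw [conjTranspose_sub, conjTranspose_smul, conjTranspose_mul, conjTranspose_mul, hP.eq, hR,
      hT.eq, Complex.star_def, Complex.conj_ofReal, Matrix.mul_assoc]
  have hZH : ((1 - P) * T * (1 - P))ᴴ = (1 - P) * T * (1 - P) := by
    rw [conjTranspose_mul, conjTranspose_mul, hR, hT.eq, Matrix.mul_assoc]
  rw [hR] at hRDR
  rw [hYH] at hY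
  rw [hZH] at hZ
  rw [pinching_sub_eq hPP T C (Complex.ofReal_ne_zero.mpr hε.ne')]
  exact ((hY.smul hεc).add hRDR).add (hZ.smul hεc)

theorem exists_posSemidef_smul_one_sub {m : Type*} [Fintype m] [DecidableEq m] (t : m → ℝ)
    (ε : ℝ) :
    ∃ C : ℝ, ((C : ℂ) • 1 - (diagonal (fun i => (t i : ℂ)) + (ε : ℂ)⁻¹ •
      (diagonal (fun i => (t i : ℂ)) * diagonal (fun i => (t i : ℂ))))).PosSemidef := by
  obtain ⟨C, hC⟩ := (Set.finite_range fun i => t i + ε⁻¹ * (t i * t i)).bddAbove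
  have hdiag : (C : ℂ) • 1 - (diagonal (fun i => (t i : ℂ)) + (ε : ℂ)⁻¹ •
      (diagonal (fun i => (t i : ℂ)) * diagonal (fun i => (t i : ℂ)))) =
        diagonal (fun i => ((C - (t i + ε⁻¹ * (t i * t i)) : ℝ) : ℂ)) := by
    rw [smul_one_eq_diagonal, diagonal_mul_diagonal, ← diagonal_smul, diagonal_add, diagonal_sub]
    congr 1
    ext i
    simp
  refine ⟨C, ?_⟩
  rw [hdiag]
  exact PosSemidef.diagonal fun i =>
    Complex.zero_le_real.mpr (sub_nonneg.mpr (hC (Set.mem_range_self i)))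

theorem exists_posSemidef_pinching {m n : Type*} [Fintype m] [DecidableEq m] [Fintype n]
    [DecidableEq n] {t : m → ℝ} {d : n → ℝ} {V : Matrix m n ℂ} (hV : Vᴴ * V = 1)
    (hd : Vᴴ * diagonal (fun i => (t i : ℂ)) * V = diagonal (fun i => (d i : ℂ)))
    {ε : ℝ} (hε : 0 < ε) :
    ∃ B : Matrix m m ℂ, B * V = V * diagonal (fun i => ((d i + ε : ℝ) : ℂ)) ∧
      (B - diagonal (fun i => (t i : ℂ))).PosSemidef := by
  have hT : (diagonal (fun i => (t i : ℂ))).IsHermitian :=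
    isHermitian_diagonal_of_self_adjoint _ (funext fun i => Complex.conj_ofReal (t i))
  obtain ⟨C, hC⟩ := exists_posSemidef_smul_one_sub t ε
  generalize diagonal (fun i => (t i : ℂ)) = T at hT hC hd ⊢
  have hPV : V * Vᴴ * V = V := by rw [Matrix.mul_assoc, hV, Matrix.mul_one]
  have hPP : V * Vᴴ * (V * Vᴴ) = V * Vᴴ := by rw [← Matrix.mul_assoc, hPV]
  refine ⟨_, ?_, posSemidef_pinching_sub hPP (isHermitian_mul_conjTranspose_self V) hT hε hC⟩
  have hD : diagonal (fun i => ((d i + ε : ℝ) : ℂ)) =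
      diagonal (fun i => (d i : ℂ)) + (ε : ℂ) • (1 : Matrix n n ℂ) := by
    rw [smul_one_eq_diagonal, diagonal_add]
    simp only [Complex.ofReal_add]
  have hPTP : V * Vᴴ * T * (V * Vᴴ) * V = V * diagonal (fun i => (d i : ℂ)) := by
    rw [← hd, Matrix.mul_assoc _ (V * Vᴴ) V, hPV]
    simp only [Matrix.mul_assoc]
  rw [hD, Matrix.mul_add, Matrix.add_mul, Matrix.add_mul, hPTP, Matrix.smul_mul,
    Matrix.smul_mul, Matrix.sub_mul, hPV, Matrix.one_mul, sub_self, smul_zero, add_zero,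
    Matrix.mul_smul, Matrix.mul_one]

namespace OperatorMonotoneDecrOn

variable {f : ℝ → ℝ}

theorem sum_add_le_sum_fin (hf : OperatorMonotoneDecrOn f) {m : ℕ} {n : Type*} [Fintype n]
    [DecidableEq n] {t : Fin m → ℝ} {d : n → ℝ} (ht : ∀ i, 0 < t i)
    {V : Matrix (Fin m) n ℂ} (hV : Vᴴ * V = 1)
    (hd : Vᴴ * diagonal (fun i => (t i : ℂ)) * V = diagonal (fun i => (d i : ℂ)))
    {ε : ℝ} (hε : 0 < ε) (x : n → ℂ) :
    ∑ i, f (d i + ε) * ‖x i‖ ^ 2 ≤ ∑ g, f (t g) * ‖(V *ᵥ x) g‖ ^ 2 := by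
  obtain ⟨B, hBV, hBT⟩ := exists_posSemidef_pinching hV hd hε
  have hT : (diagonal (fun i => (t i : ℂ))).PosDef :=
    PosDef.diagonal fun i => Complex.zero_lt_real.mpr (ht i)
  have hB : B.PosDef := by
    have := hT.add_posSemidef hBT
    rwa [add_sub_cancel] at this
  have hfT : herCFC f hT.1 = diagonal (fun i => (f (t i) : ℂ)) := by
    have := herCFC_mul_of_mul_eq f hT.1 (X := 1) (d := t)
      (by rw [Matrix.one_mul, Matrix.mul_one])
    rwa [Matrix.one_mul, Matrix.mul_one] at this
  have hpsd := hf m _ B hT hB hBT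
  have hq := hpsd.dotProduct_mulVec_nonneg (V *ᵥ x)
  have hfB : star (V *ᵥ x) ⬝ᵥ (herCFC f hB.1 *ᵥ (V *ᵥ x)) =
      star x ⬝ᵥ (diagonal (fun i => (f (d i + ε) : ℂ)) *ᵥ x) := by
    rw [mulVec_mulVec, herCFC_mul_of_mul_eq f hB.1 hBV, star_mulVec, ← dotProduct_mulVec,
      mulVec_mulVec, ← Matrix.mul_assoc, hV, Matrix.one_mul]
  rw [sub_mulVec, dotProduct_sub, hfB, hfT] at hq
  have hre := (Complex.le_def.mp hq).1
  rw [Complex.sub_re, re_star_dotProduct_diagonal_mulVec,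
    re_star_dotProduct_diagonal_mulVec (fun i => f (d i + ε)), Complex.zero_re] at hre
  exact sub_nonneg.mp hre

/-- The quadratic form inequality `f(V*TV + ε) ≤ V* f(T) V` for an isometry `V`, with `T` and
`V*TV` diagonal. -/
theorem sum_add_le_sum (hf : OperatorMonotoneDecrOn f) {m n : Type*} [Fintype m] [DecidableEq m]
    [Fintype n] [DecidableEq n] {t : m → ℝ} {d : n → ℝ} (ht : ∀ i, 0 < t i)
    {V : Matrix m n ℂ} (hV : Vᴴ * V = 1)
    (hd : Vᴴ * diagonal (fun i => (t i : ℂ)) * V = diagonal (fun i => (d i : ℂ)))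
    {ε : ℝ} (hε : 0 < ε) (x : n → ℂ) :
    ∑ i, f (d i + ε) * ‖x i‖ ^ 2 ≤ ∑ g, f (t g) * ‖(V *ᵥ x) g‖ ^ 2 := by
  let e : Fin (Fintype.card m) ≃ m := (Fintype.equivFin m).symm
  have hV' : (V.submatrix e id)ᴴ * V.submatrix e id = 1 := by
    rw [conjTranspose_submatrix, submatrix_mul_equiv, hV, submatrix_id_id]
  have hd' : (V.submatrix e id)ᴴ * diagonal (fun i => (t (e i) : ℂ)) * V.submatrix e id =
      diagonal (fun i => (d i : ℂ)) := by
    have : diagonal (fun i => (t (e i) : ℂ)) = (diagonal (fun i => (t i : ℂ))).submatrix e e :=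
      (submatrix_diagonal_equiv (fun i => (t i : ℂ)) e).symm
    rw [this, conjTranspose_submatrix, submatrix_mul_equiv, submatrix_mul_equiv, hd,
      submatrix_id_id]
  have := hf.sum_add_le_sum_fin (t := t ∘ e) (fun i => ht (e i)) hV' hd' hε x
  exact this.trans_eq (e.sum_comp fun g => f (t g) * ‖(V *ᵥ x) g‖ ^ 2)

theorem antitoneOn (hf : OperatorMonotoneDecrOn f) : AntitoneOn f (Set.Ioi 0) := by
  intro a ha b _ hab
  rcases hab.eq_or_lt with rfl | hlt
  · rfl
  have := hf.sum_add_le_sum (m := Unit) (n := Unit) (t := fun _ => a) (d := fun _ => a) (V := 1)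
    (fun _ => ha) (by simp) (by simp) (sub_pos.mpr hlt) (fun _ => 1)
  simpa using this

theorem apply_le_of_add_lt (hf : OperatorMonotoneDecrOn f) {a b c w : ℝ} (ha : 0 < a) (hb : 0 < b)
    (hw : 0 ≤ w) (hw1 : w ≤ 1) (hc : w * a + (1 - w) * b < c) :
    f c ≤ w * f a + (1 - w) * f b := by
  have hw1' : 0 ≤ 1 - w := sub_nonneg.mpr hw1
  have hs : ((√w : ℝ) : ℂ) * (√w : ℝ) = w := by rw [← Complex.ofReal_mul, Real.mul_self_sqrt hw]
  have hs' : ((√(1 - w) : ℝ) : ℂ) * (√(1 - w) : ℝ) = ((1 - w : ℝ) : ℂ) := by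
    rw [← Complex.ofReal_mul, Real.mul_self_sqrt hw1']
  have := hf.sum_add_le_sum (m := Fin 2) (n := Unit) (t := ![a, b])
    (d := fun _ => w * a + (1 - w) * b)
    (V := of fun i _ => ((![√w, √(1 - w)] i : ℝ) : ℂ))
    (by intro i; fin_cases i <;> simpa)
    (by
      ext i j
      simp [Matrix.mul_apply, hs, hs'])
    (by
      ext i j
      simp only [Matrix.mul_apply, Fin.sum_univ_two, diagonal_apply]
      simp only [of_apply, conjTranspose_apply, Complex.star_def, Complex.conj_ofReal]
      simp
      push_cast at hs'
      linear_combination (a : ℂ) * hs + (b : ℂ) * hs')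
    (sub_pos.mpr hc) (fun _ => 1)
  simpa [Fin.sum_univ_two, mulVec, dotProduct, Real.sq_sqrt hw, Real.sq_sqrt hw1', mul_comm,
    abs_of_nonneg] using this

theorem tendsto_add_nhdsGT (hf : OperatorMonotoneDecrOn f) {a : ℝ} (ha : 0 < a) :
    Filter.Tendsto (fun ε => f (a + ε)) (nhdsWithin 0 (Set.Ioi 0)) (nhds (f a)) := by
  have hlim : Filter.Tendsto (fun ε : ℝ => f a - 2 * ε / a * (f (a / 2) - f (a + 1)))
      (nhdsWithin 0 (Set.Ioi 0)) (nhds (f a)) := by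
    have hc : Continuous fun ε : ℝ => f a - 2 * ε / a * (f (a / 2) - f (a + 1)) := by fun_prop
    simpa using (hc.tendsto 0).mono_left nhdsWithin_le_nhds
  have hmem : Set.Ioo 0 (min 1 (a / 2)) ∈ nhdsWithin (0 : ℝ) (Set.Ioi 0) :=
    Ioo_mem_nhdsGT (lt_min one_pos (half_pos ha))
  refine tendsto_of_tendsto_of_tendsto_of_le_of_le' hlim tendsto_const_nhds ?_ ?_ <;>
    filter_upwards [hmem] with ε hε
  · have hε0 : 0 < ε := hε.1
    obtain ⟨hε1, hεa⟩ := lt_min_iff.mp hε.2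
    have hw : 0 < 2 * ε / a := by positivity
    have hw1 : 2 * ε / a ≤ 1 := by rw [div_le_one ha]; linarith
    have hwa : 2 * ε / a * a = 2 * ε := div_mul_cancel₀ _ ha.ne'
    have hconv := hf.apply_le_of_add_lt (c := a) (half_pos ha) (add_pos ha hε0) hw.le hw1
      (by nlinarith [mul_pos hw hε0])
    have hanti : f (a + 1) ≤ f (a + ε) :=
      hf.antitoneOn (add_pos ha hε0) (add_pos ha one_pos) (by linarith)
    linarith [mul_le_mul_of_nonneg_left hanti hw.le]
  · exact hf.antitoneOn ha (add_pos ha hε.1) (le_add_of_nonneg_right hε.1.le)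

/-- The operator Jensen inequality `f(∑ V_j* T_j V_j) ≤ ∑ V_j* f(T_j) V_j` as an inequality of
quadratic forms, with `T_j` and `∑ V_j* T_j V_j` diagonal. -/
theorem sum_le_sum_of_isometry (hf : OperatorMonotoneDecrOn f) {J m n : Type*} [Fintype J]
    [Fintype m] [DecidableEq m] [Fintype n] [DecidableEq n] {t : J → m → ℝ} {d : n → ℝ}
    (ht : ∀ j i, 0 < t j i) (hd0 : ∀ i, 0 < d i) {V : J → Matrix m n ℂ}
    (hV : ∑ j, (V j)ᴴ * V j = 1)
    (hd : ∑ j, (V j)ᴴ * diagonal (fun i => (t j i : ℂ)) * V j = diagonal (fun i => (d i : ℂ)))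
    (x : n → ℂ) :
    ∑ i, f (d i) * ‖x i‖ ^ 2 ≤ ∑ j, ∑ g, f (t j g) * ‖(V j *ᵥ x) g‖ ^ 2 := by
  classical
  have hlim : Filter.Tendsto (fun ε => ∑ i, f (d i + ε) * ‖x i‖ ^ 2)
      (nhdsWithin 0 (Set.Ioi 0)) (nhds (∑ i, f (d i) * ‖x i‖ ^ 2)) :=
    tendsto_finsetSum _ fun i _ => (hf.tendsto_add_nhdsGT (hd0 i)).mul_const _
  refine le_of_tendsto hlim ?_
  filter_upwards [self_mem_nhdsWithin] with ε hε
  refine (hf.sum_add_le_sum (m := J × m) (t := fun g => t g.1 g.2) (d := d)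
    (V := of fun g h => V g.1 g.2 h) (fun g => ht g.1 g.2) ?_ ?_ hε x).trans_eq
      (Fintype.sum_prod_type _)
  · rw [← hV]
    ext a b
    simp [Matrix.mul_apply, Matrix.sum_apply, Fintype.sum_prod_type]
  · rw [← hd]
    ext a b
    simp [Matrix.mul_apply (M := _ * _), Matrix.sum_apply, Fintype.sum_prod_type, mul_diagonal]

end OperatorMonotoneDecrOn

theorem conjTranspose_mul_self_of_orthonormal {ι : Type*} [Fintype ι] [DecidableEq ι]
    {ψ : ι → ι → ℂ} (h : ∀ i i', star (ψ i) ⬝ᵥ ψ i' = if i = i' then 1 else 0) :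
    ((of ψ)ᵀ)ᴴ * (of ψ)ᵀ = 1 := by
  ext i i'
  rw [one_apply, ← h i i']
  rfl

theorem sum_smul_outer {ι : Type*} [Fintype ι] [DecidableEq ι] (a : ι → ℝ) (ψ : ι → ι → ℂ) :
    ∑ i, (a i : ℂ) • outer (ψ i) =
      (of ψ)ᵀ * diagonal (fun i => (a i : ℂ)) * ((of ψ)ᵀ)ᴴ := by
  ext i j
  simp only [Matrix.sum_apply, Matrix.mul_apply (M := _ * _), mul_diagonal, Matrix.smul_apply,
    outer, vecMulVec_apply, smul_eq_mul, transpose_apply, conjTranspose_apply, of_apply,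
    Pi.star_apply]
  exact Finset.sum_congr rfl fun k _ => by ring

theorem star_dotProduct_mulVec_eq {ι : Type*} [Fintype ι] (K : Matrix ι ι ℂ)
    (φ ψ : ι → ι → ℂ) (k i : ι) :
    star (φ k) ⬝ᵥ (K *ᵥ ψ i) = (((of φ)ᵀ)ᴴ * K * (of ψ)ᵀ) k i := by
  rw [Matrix.mul_assoc]
  rfl

open scoped Kronecker

/-- The matrix of `X ↦ X ρ^{-1/2} ρ₂^{1/2}` from the eigenbasis `|φ_k⟩⟨ψ_i|` to the eigenbasis
`|χ_k⟩⟨ω_i|`, where `Ψ, Φ, Ψ₂, Φ₂` have the eigenvectors as columns and `lam`, `lam₂` are the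
eigenvalues of `ρ`, `ρ₂`. -/
noncomputable def transition {ι : Type*} [Fintype ι] [DecidableEq ι] (lam lam₂ : ι → ℝ)
    (Ψ Φ Ψ₂ Φ₂ : Matrix ι ι ℂ) : Matrix (ι × ι) (ι × ι) ℂ :=
  (diagonal (fun i => (√(lam₂ i) : ℂ)) * (Ψᴴ * Ψ₂)ᵀ * diagonal (fun i => ((√(lam i))⁻¹ : ℂ))) ⊗ₖ
    (Φ₂ᴴ * Φ)

theorem conjTranspose_mul_mul_conjTranspose_mul {m n : Type*} [Fintype m] [Fintype n]
    [DecidableEq n] {U : Matrix m n ℂ} (hU : Uᴴ * U = 1) (D : Matrix n n ℂ) :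
    Uᴴ * (U * D * Uᴴ) * U = D := by
  rw [Matrix.mul_assoc, Matrix.mul_assoc _ Uᴴ, hU, Matrix.mul_one, ← Matrix.mul_assoc, hU,
    Matrix.one_mul]

section Transition

variable {ι : Type*} [Fintype ι] [DecidableEq ι] {lam lam₂ : ι → ℝ} {Ψ Φ Ψ₂ Φ₂ : Matrix ι ι ℂ}

theorem conjTranspose_transition_mul_mul (hlam₂ : ∀ i, 0 ≤ lam₂ i) (w v : ι → ℂ) :
    (transition lam lam₂ Ψ Φ Ψ₂ Φ₂)ᴴ * diagonal (fun g => w g.1 * v g.2) *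
        transition lam lam₂ Ψ Φ Ψ₂ Φ₂ =
      (diagonal (fun i => ((√(lam i))⁻¹ : ℂ)) *
        (Ψᴴ * (Ψ₂ * diagonal (fun i => lam₂ i * w i) * Ψ₂ᴴ) * Ψ)ᵀ *
        diagonal (fun i => ((√(lam i))⁻¹ : ℂ))) ⊗ₖ (Φᴴ * (Φ₂ * diagonal v * Φ₂ᴴ) * Φ) := by
  have hs : diagonal (fun i => (lam₂ i * w i : ℂ)) =
      diagonal (fun i => (√(lam₂ i) : ℂ)) * diagonal w * diagonal (fun i => (√(lam₂ i) : ℂ)) := by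
    rw [diagonal_mul_diagonal, diagonal_mul_diagonal]
    congr 1
    ext i
    rw [mul_right_comm, ← Complex.ofReal_mul, Real.mul_self_sqrt (hlam₂ i)]
  have hsH : (diagonal (fun i => (√(lam₂ i) : ℂ)))ᴴ = diagonal (fun i => (√(lam₂ i) : ℂ)) :=
    isHermitian_diagonal_of_self_adjoint _ (funext fun i => Complex.conj_ofReal _)
  have hrH : (diagonal (fun i => ((√(lam i))⁻¹ : ℂ)))ᴴ =
      diagonal (fun i => ((√(lam i))⁻¹ : ℂ)) :=
    isHermitian_diagonal_of_self_adjoint _ (funext fun i => by simp)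
  have hCH : ((Ψᴴ * Ψ₂)ᵀ)ᴴ = (Ψ₂ᴴ * Ψ)ᵀ := by
    change ((Ψᴴ * Ψ₂)ᴴ)ᵀ = _
    rw [conjTranspose_mul, conjTranspose_conjTranspose]
  rw [transition, conjTranspose_kronecker, ← diagonal_kronecker_diagonal, ← mul_kronecker_mul,
    ← mul_kronecker_mul, hs]
  congr 1
  · rw [conjTranspose_mul, conjTranspose_mul, hCH, hsH, hrH]
    simp only [transpose_mul, diagonal_transpose, Matrix.mul_assoc]
  · simp only [conjTranspose_mul, conjTranspose_conjTranspose, Matrix.mul_assoc]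

theorem conjTranspose_transition_mul_self (hlam₂ : ∀ i, 0 ≤ lam₂ i) (hΦ : Φᴴ * Φ = 1)
    (hΦ₂ : Φ₂ * Φ₂ᴴ = 1) :
    (transition lam lam₂ Ψ Φ Ψ₂ Φ₂)ᴴ * transition lam lam₂ Ψ Φ Ψ₂ Φ₂ =
      (diagonal (fun i => ((√(lam i))⁻¹ : ℂ)) *
        (Ψᴴ * (Ψ₂ * diagonal (fun i => (lam₂ i : ℂ)) * Ψ₂ᴴ) * Ψ)ᵀ *
        diagonal (fun i => ((√(lam i))⁻¹ : ℂ))) ⊗ₖ (1 : Matrix ι ι ℂ) := by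
  have h := conjTranspose_transition_mul_mul (lam := lam) (Ψ := Ψ) (Φ := Φ) (Ψ₂ := Ψ₂)
    (Φ₂ := Φ₂) hlam₂ (fun _ => 1) (fun _ => 1)
  simpa only [mul_one, diagonal_one, Matrix.mul_one, hΦ₂, hΦ] using h

theorem inv_sqrt_mul_inv_sqrt {a : ℝ} (ha : 0 ≤ a) :
    (√a : ℂ)⁻¹ * (√a : ℂ)⁻¹ = (a : ℂ)⁻¹ := by
  rw [← mul_inv, ← Complex.ofReal_mul, Real.mul_self_sqrt ha]

theorem conjTranspose_transition_mul_diagonal_mul (hlam : ∀ i, 0 ≤ lam i)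
    (hlam₂ : ∀ i, 0 < lam₂ i) (hΨ : Ψᴴ * Ψ = 1) (hΨ₂ : Ψ₂ * Ψ₂ᴴ = 1) (mu' : ι → ℝ) :
    (transition lam lam₂ Ψ Φ Ψ₂ Φ₂)ᴴ * diagonal (fun g => ((mu' g.2 / lam₂ g.1 : ℝ) : ℂ)) *
        transition lam lam₂ Ψ Φ Ψ₂ Φ₂ =
      diagonal (fun i => ((lam i)⁻¹ : ℂ)) ⊗ₖ
        (Φᴴ * (Φ₂ * diagonal (fun i => (mu' i : ℂ)) * Φ₂ᴴ) * Φ) := by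
  have h := conjTranspose_transition_mul_mul (lam := lam) (Ψ := Ψ) (Φ := Φ) (Ψ₂ := Ψ₂)
    (Φ₂ := Φ₂) (fun i => (hlam₂ i).le) (fun i => (lam₂ i : ℂ)⁻¹) (fun i => (mu' i : ℂ))
  have hl : ∀ i, (lam₂ i : ℂ) * (lam₂ i : ℂ)⁻¹ = 1 := fun i =>
    mul_inv_cancel₀ (Complex.ofReal_ne_zero.mpr (hlam₂ i).ne')
  simp only [hl, diagonal_one, Matrix.mul_one, hΨ₂, hΨ, transpose_one, diagonal_mul_diagonal,
    inv_sqrt_mul_inv_sqrt (hlam _)] at h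
  rw [← h]
  simp only [div_eq_inv_mul, Complex.ofReal_mul, Complex.ofReal_inv]

theorem transition_mulVec_vec (hlam : ∀ i, 0 < lam i) (hΨ : Ψ * Ψᴴ = 1) (hΦ : Φ * Φᴴ = 1)
    (K : Matrix ι ι ℂ) :
    transition lam lam₂ Ψ Φ Ψ₂ Φ₂ *ᵥ
        vec (Φᴴ * K * Ψ * diagonal (fun i => (√(lam i) : ℂ))) =
      vec (Φ₂ᴴ * K * Ψ₂ * diagonal (fun i => (√(lam₂ i) : ℂ))) := by
  have hr : diagonal (fun i => (√(lam i) : ℂ)) * diagonal (fun i => ((√(lam i))⁻¹ : ℂ)) = 1 := by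
    rw [diagonal_mul_diagonal, ← diagonal_one]
    congr 1
    ext i
    exact mul_inv_cancel₀ (Complex.ofReal_ne_zero.mpr (Real.sqrt_pos.mpr (hlam i)).ne')
  rw [transition, kronecker_mulVec_vec]
  congr 1
  simp only [transpose_mul, diagonal_transpose, transpose_transpose]
  calc _ = Φ₂ᴴ * (Φ * Φᴴ) * K * Ψ * (diagonal (fun i => (√(lam i) : ℂ)) *
        diagonal (fun i => ((√(lam i))⁻¹ : ℂ))) * Ψᴴ * Ψ₂ *
          diagonal (fun i => (√(lam₂ i) : ℂ)) := by simp only [Matrix.mul_assoc]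
    _ = Φ₂ᴴ * K * (Ψ * Ψᴴ) * Ψ₂ * diagonal (fun i => (√(lam₂ i) : ℂ)) := by
      rw [hΦ, hr]
      simp only [Matrix.mul_assoc, Matrix.mul_one]
    _ = _ := by rw [hΨ, Matrix.mul_one]

end Transition

theorem quasiEntropy_eq_sum_vec {ι : Type*} [Fintype ι] [DecidableEq ι] (f : ℝ → ℝ)
    (K : Matrix ι ι ℂ) {lam : ι → ℝ} (hlam : ∀ i, 0 ≤ lam i) (ψ : ι → ι → ℂ) (mu : ι → ℝ)
    (φ : ι → ι → ℂ) :
    quasiEntropy f K lam ψ mu φ = ∑ g : ι × ι, f (mu g.2 / lam g.1) *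
      ‖vec (((of φ)ᵀ)ᴴ * K * (of ψ)ᵀ * diagonal (fun i => (√(lam i) : ℂ))) g‖ ^ 2 := by
  rw [quasiEntropy, Fintype.sum_prod_type]
  refine Finset.sum_congr rfl fun i _ => Finset.sum_congr rfl fun k _ => ?_
  rw [star_dotProduct_mulVec_eq, vec, mul_diagonal, norm_mul, mul_pow, Complex.norm_real,
    Real.norm_eq_abs, sq_abs, Real.sq_sqrt (hlam i)]
  ring

theorem sum_kronecker {J l m n o : Type*} [Fintype J] (A : J → Matrix l m ℂ) (B : Matrix n o ℂ) :
    (∑ j, A j) ⊗ₖ B = ∑ j, A j ⊗ₖ B := by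
  ext
  simp [Matrix.sum_apply, Finset.sum_mul]

theorem kronecker_sum {J l m n o : Type*} [Fintype J] (A : Matrix l m ℂ) (B : J → Matrix n o ℂ) :
    A ⊗ₖ (∑ j, B j) = ∑ j, A ⊗ₖ B j := by
  ext
  simp [Matrix.sum_apply, Finset.mul_sum]

/-- Joint convexity of the quasi-relative entropy: for operator monotone decreasing `f`
with `f(1)=0`, any `K`, weights `p_j > 0` summing to `1`, and invertible density matrices
`ρ_j, σ_j` with `ρ = Σ p_j ρ_j`, `σ = Σ p_j σ_j`, one has
`S_f^K(ρ||σ) ≤ Σ_j p_j S_f^K(ρ_j||σ_j)`. -/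
theorem quasiEntropy_jointly_convex {ι J : Type*} [Fintype ι] [DecidableEq ι] [Fintype J]
    (f : ℝ → ℝ) (hf : OperatorMonotoneDecrOn f) (hf1 : f 1 = 0)
    (K : Matrix ι ι ℂ) (p : J → ℝ) (hp : ∀ j, 0 < p j) (hps : ∑ j, p j = 1)
    (ρs σs : J → Matrix ι ι ℂ) (ρ σ : Matrix ι ι ℂ)
    (hρ : ρ = ∑ j, (p j : ℂ) • ρs j) (hσ : σ = ∑ j, (p j : ℂ) • σs j)
    (lams : J → ι → ℝ) (ψs : J → ι → ι → ℂ) (mus : J → ι → ℝ) (φs : J → ι → ι → ℂ)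
    (hψs : ∀ j i i', star (ψs j i) ⬝ᵥ ψs j i' = if i = i' then 1 else 0)
    (hφs : ∀ j i i', star (φs j i) ⬝ᵥ φs j i' = if i = i' then 1 else 0)
    (hlams : ∀ j i, 0 < lams j i) (hmus : ∀ j i, 0 < mus j i)
    (hρs : ∀ j, ρs j = ∑ i, (lams j i : ℂ) • outer (ψs j i))
    (hσs : ∀ j, σs j = ∑ i, (mus j i : ℂ) • outer (φs j i))
    (hρtr : ∀ j, ∑ i, lams j i = 1) (hσtr : ∀ j, ∑ i, mus j i = 1)
    (lam : ι → ℝ) (ψ : ι → ι → ℂ) (mu : ι → ℝ) (φ : ι → ι → ℂ)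
    (hψ : ∀ i i', star (ψ i) ⬝ᵥ ψ i' = if i = i' then 1 else 0)
    (hφ : ∀ i i', star (φ i) ⬝ᵥ φ i' = if i = i' then 1 else 0)
    (hlam : ∀ i, 0 < lam i) (hmu : ∀ i, 0 < mu i)
    (hρdec : ρ = ∑ i, (lam i : ℂ) • outer (ψ i))
    (hσdec : σ = ∑ i, (mu i : ℂ) • outer (φ i)) :
    quasiEntropy f K lam ψ mu φ ≤
      ∑ j, p j * quasiEntropy f K (lams j) (ψs j) (mus j) (φs j) := by
  simp only [sum_smul_outer] at hρs hσs hρdec hσdec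
  rw [quasiEntropy_eq_sum_vec f K fun i => (hlam i).le]
  simp only [quasiEntropy_eq_sum_vec f K fun i => (hlams _ i).le]
  have hΨ := conjTranspose_mul_self_of_orthonormal hψ
  have hΦ := conjTranspose_mul_self_of_orthonormal hφ
  have hΨs := fun j => mul_eq_one_comm.mp (conjTranspose_mul_self_of_orthonormal (hψs j))
  have hΦs := fun j => mul_eq_one_comm.mp (conjTranspose_mul_self_of_orthonormal (hφs j))
  generalize (of ψ)ᵀ = Ψ at *
  generalize (of φ)ᵀ = Φ at *
  obtain ⟨Ψs, hΨs_eq⟩ : ∃ Ψs : J → Matrix ι ι ℂ, ∀ j, (of (ψs j))ᵀ = Ψs j := ⟨_, fun _ => rfl⟩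
  obtain ⟨Φs, hΦs_eq⟩ : ∃ Φs : J → Matrix ι ι ℂ, ∀ j, (of (φs j))ᵀ = Φs j := ⟨_, fun _ => rfl⟩
  simp only [hΨs_eq, hΦs_eq] at hρs hσs hΨs hΦs ⊢
  have hsqrt : ∀ j, (√(p j) : ℂ) * star (√(p j) : ℂ) = p j := fun j => by
    rw [Complex.star_def, Complex.conj_ofReal, ← Complex.ofReal_mul,
      Real.mul_self_sqrt (hp j).le]
  refine (hf.sum_le_sum_of_isometry (t := fun j g => mus j g.2 / lams j g.1)
    (V := fun j => (√(p j) : ℂ) • transition lam (lams j) Ψ Φ (Ψs j) (Φs j))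
    (fun j g => div_pos (hmus j g.2) (hlams j g.1))
    (fun g => div_pos (hmu g.2) (hlam g.1)) ?_ ?_ _).trans_eq ?_
  · have hρΨ : Ψᴴ * ρ * Ψ = diagonal (fun i => (lam i : ℂ)) := by
      rw [hρdec, conjTranspose_mul_mul_conjTranspose_mul hΨ]
    have hsum : ∑ j, (p j : ℂ) • (diagonal (fun i => ((√(lam i))⁻¹ : ℂ)) * (Ψᴴ * ρs j * Ψ)ᵀ *
        diagonal (fun i => ((√(lam i))⁻¹ : ℂ))) = 1 := by
      calc _ = diagonal (fun i => ((√(lam i))⁻¹ : ℂ)) * (Ψᴴ * ρ * Ψ)ᵀ *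
            diagonal (fun i => ((√(lam i))⁻¹ : ℂ)) := by
            simp only [hρ, Matrix.mul_sum, Matrix.sum_mul, transpose_sum, Matrix.mul_smul,
              Matrix.smul_mul, transpose_smul]
        _ = 1 := by
          rw [hρΨ, diagonal_transpose, diagonal_mul_diagonal, diagonal_mul_diagonal,
            ← diagonal_one]
          congr 1
          ext i
          rw [mul_right_comm, inv_sqrt_mul_inv_sqrt (hlam i).le,
            inv_mul_cancel₀ (Complex.ofReal_ne_zero.mpr (hlam i).ne')]
    simp only [conjTranspose_smul, Matrix.smul_mul, Matrix.mul_smul, smul_smul, hsqrt,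
      conjTranspose_transition_mul_self (fun i => (hlams _ i).le) hΦ (hΦs _), ← hρs,
      ← smul_kronecker]
    rw [← sum_kronecker, hsum, one_kronecker_one]
  · have hσΦ : Φᴴ * σ * Φ = diagonal (fun i => (mu i : ℂ)) := by
      rw [hσdec, conjTranspose_mul_mul_conjTranspose_mul hΦ]
    have hsum : ∑ j, (p j : ℂ) • (Φᴴ * σs j * Φ) = diagonal (fun i => (mu i : ℂ)) := by
      rw [← hσΦ, hσ]
      simp only [Matrix.mul_sum, Matrix.sum_mul, Matrix.mul_smul, Matrix.smul_mul]
    simp only [conjTranspose_smul, Matrix.smul_mul, Matrix.mul_smul, smul_smul, hsqrt,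
      conjTranspose_transition_mul_diagonal_mul (fun i => (hlam i).le) (hlams _) hΨ (hΨs _),
      ← hσs, ← kronecker_smul]
    rw [← kronecker_sum, hsum, diagonal_kronecker_diagonal]
    simp only [div_eq_inv_mul, Complex.ofReal_mul, Complex.ofReal_inv]
  · refine Finset.sum_congr rfl fun j _ => ?_
    rw [Finset.mul_sum]
    refine Finset.sum_congr rfl fun g _ => ?_
    rw [smul_mulVec, transition_mulVec_vec hlam (mul_eq_one_comm.mp hΨ) (mul_eq_one_comm.mp hΦ),
      Pi.smul_apply, norm_smul, mul_pow, Complex.norm_real, Real.norm_eq_abs, sq_abs,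
      Real.sq_sqrt (hp j).le]
    ring
end
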